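/- Let z : ℝ → ℝ ∪ {+∞} be an energy satisfying (z1)–(z3) and define e from z as above. Then for all a₀, a₁ ∈ ℝ with z(a₀) ≠ +∞ and z(a₁) ≠ +∞, and every b₀ ∈ ∂z(a₀): e(a₁) − e(a₀) ≥ (a₁ − a₀)·(a₀·b₀ − z(a₀)). Consequently, for every a₀ with z(a₀) ≠ +∞ and every b₀ ∈ ∂z(a₀), the number a₀·b₀ − z(a₀) belongs to ∂e(a₀). -/

import Mathlib

open MeasureTheory Filter Set Topology

noncomputable section

/-- Convexity for `EReal`-valued functions on `ℝ`. -/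
def ConvexE (f : ℝ → EReal) : Prop :=
  ∀ x y t : ℝ, 0 < t → t < 1 →
    f (t * x + (1 - t) * y) ≤ (t : EReal) * f x + ((1 - t) : EReal) * f y

/-- Subdifferential of an `EReal`-valued function at a point. -/
def subdiff (f : ℝ → EReal) (a : ℝ) : Set ℝ :=
  {b : ℝ | ∀ x : ℝ, f a + ((b * (x - a) : ℝ) : EReal) ≤ f x}

/-- Convex (Legendre) conjugate. -/
noncomputable def conj (f : ℝ → EReal) (b : ℝ) : EReal :=
  ⨆ a : ℝ, ((a * b : ℝ) : EReal) - f a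

/-- An energy satisfying assumptions (z1)-(z3). -/
structure IsEnergy (z : ℝ → EReal) : Prop where
  proper : ∃ a : ℝ, z a ≠ ⊤
  ne_bot : ∀ a : ℝ, z a ≠ ⊥
  lsc : LowerSemicontinuous z
  convex : ConvexE z
  top_of_neg : ∀ a : ℝ, a < 0 → z a = ⊤
  zero : z 0 = 0
  slope : ∃ a : ℝ, 0 < a ∧ ∃ L : ℝ, subdiff z a = {L} ∧ ∀ c ∈ subdiff z 0, c < L

/-- The transformed energy `e(a) = a z(a) - 2∫₀^a z(s) ds` (where `z(a)` is finite),
`+∞` otherwise. -/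
noncomputable def eFun (z : ℝ → EReal) (a : ℝ) : EReal :=
  if z a = ⊤ then ⊤
  else ((a * (z a).toReal - 2 * ∫ s in (0:ℝ)..a, (z s).toReal : ℝ) : EReal)

theorem aux_chord (z : ℝ → EReal) (hz : IsEnergy z) {x y s : ℝ} (hx : z x ≠ ⊤) (hy : z y ≠ ⊤)
    (h1 : x ≤ s) (h2 : s ≤ y) :
    z s ≠ ⊤ ∧ (y - x) * (z s).toReal ≤ (y - s) * (z x).toReal + (s - x) * (z y).toReal := by
  rcases eq_or_lt_of_le h1 with rfl | h1
  · exact ⟨hx, by linarith⟩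
  rcases eq_or_lt_of_le h2 with rfl | h2
  · exact ⟨hy, by linarith⟩
  have hd : 0 < y - x := by linarith
  have h := hz.convex x y ((y - s) / (y - x)) (by apply div_pos <;> linarith)
    (by rw [div_lt_one hd]; linarith)
  have e1 : (y - s) / (y - x) * x + (1 - (y - s) / (y - x)) * y = s := by
    field_simp; ring
  rw [e1] at h
  lift z x to ℝ using ⟨hx, hz.ne_bot x⟩ with fx
  lift z y to ℝ using ⟨hy, hz.ne_bot y⟩ with fy
  have h' : z s ≤ (((y - s) / (y - x) * fx + (1 - (y - s) / (y - x)) * fy : ℝ) : EReal) := by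
    push_cast at h ⊢
    exact h
  have hs : z s ≠ ⊤ := fun hh => by rw [hh] at h'; exact EReal.coe_ne_top _ (top_le_iff.1 h')
  refine ⟨hs, ?_⟩
  lift z s to ℝ using ⟨hs, hz.ne_bot s⟩ with fs
  have h3 : fs ≤ (y - s) / (y - x) * fx + (1 - (y - s) / (y - x)) * fy := by exact_mod_cast h'
  simp only [EReal.toReal_coe]
  calc (y - x) * fs ≤ (y - x) * ((y - s) / (y - x) * fx + (1 - (y - s) / (y - x)) * fy) := by
        gcongr
    _ = _ := by field_simp; ring

theorem aux_sub (z : ℝ → EReal) (hz : IsEnergy z) {a b x : ℝ} (ha : z a ≠ ⊤) (hx : z x ≠ ⊤)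
    (hb : b ∈ subdiff z a) : (z a).toReal + b * (x - a) ≤ (z x).toReal := by
  have h := hb x
  lift z x to ℝ using ⟨hx, hz.ne_bot x⟩ with fx
  lift z a to ℝ using ⟨ha, hz.ne_bot a⟩ with fa
  simp only [EReal.toReal_coe]
  exact_mod_cast h

theorem aux_nonneg (z : ℝ → EReal) (hz : IsEnergy z) {a : ℝ} (ha : z a ≠ ⊤) : 0 ≤ a := by
  by_contra h
  exact ha (hz.top_of_neg a (by linarith))

theorem aux_int (z : ℝ → EReal) (hz : IsEnergy z) {a b M : ℝ} (ha : z a ≠ ⊤)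
    (hb : b ∈ subdiff z a) (hM : z M ≠ ⊤) :
    IntervalIntegrable (fun s => (z s).toReal) volume 0 M := by
  have hM0 := aux_nonneg z hz hM
  have hm : Measurable (fun s => (z s).toReal) := hz.lsc.measurable.ereal_toReal
  rw [intervalIntegrable_iff_integrableOn_Ioc_of_le hM0]
  refine Measure.integrableOn_of_bounded
    (M := |(z M).toReal| + |(z a).toReal| + |b| * (M + |a|)) (by simp)
    hm.aestronglyMeasurable ?_
  refine (ae_restrict_iff' measurableSet_Ioc).2 (Eventually.of_forall fun s hs => ?_)
  have h0 : z 0 ≠ ⊤ := by rw [hz.zero]; simp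
  obtain ⟨hsf, hc⟩ := aux_chord z hz h0 hM hs.1.le hs.2
  have hl := aux_sub z hz ha hsf hb
  have hMp : 0 < M := lt_of_lt_of_le hs.1 hs.2
  rw [hz.zero] at hc
  simp only [EReal.toReal_zero, sub_zero, mul_zero, zero_add] at hc
  have hb' : |b * (s - a)| ≤ |b| * (M + |a|) := by
    rw [abs_mul]
    gcongr
    rw [abs_le]
    constructor <;> linarith [le_abs_self a, neg_abs_le a, hs.1, hs.2]
  have hu : (z s).toReal ≤ |(z M).toReal| := by
    have : M * (z s).toReal ≤ M * |(z M).toReal| := by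
      calc _ ≤ _ := hc
        _ ≤ s * |(z M).toReal| := by gcongr; exacts [hs.1.le, le_abs_self _]
        _ ≤ _ := by gcongr; exact hs.2
    exact le_of_mul_le_mul_left this hMp
  rw [Real.norm_eq_abs, abs_le]
  have := abs_le.1 hb'
  have := abs_nonneg (z M).toReal
  constructor <;> linarith [le_abs_self (z a).toReal, neg_abs_le (z a).toReal, abs_nonneg (z a).toReal]

theorem aux_real (z : ℝ → EReal) (hz : IsEnergy z) {a₀ a₁ b₀ : ℝ} (h0 : z a₀ ≠ ⊤) (h1 : z a₁ ≠ ⊤)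
    (hb : b₀ ∈ subdiff z a₀) :
    (a₀ * (z a₀).toReal - 2 * ∫ s in (0:ℝ)..a₀, (z s).toReal)
      + (a₁ - a₀) * (a₀ * b₀ - (z a₀).toReal) ≤
    a₁ * (z a₁).toReal - 2 * ∫ s in (0:ℝ)..a₁, (z s).toReal := by
  have i0 := aux_int z hz h0 hb h0
  have i1 := aux_int z hz h0 hb h1
  have p0 := aux_nonneg z hz h0
  have p1 := aux_nonneg z hz h1
  have hs := aux_sub z hz h0 h1 hb
  rcases le_total a₀ a₁ with h | h
  · have key : (a₁ - a₀) * ∫ s in a₀..a₁, (z s).toReal ≤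
        (a₁ - a₀) * ((a₁ - a₀) * ((z a₀).toReal + (z a₁).toReal) / 2) := by
      have e : ∫ s in a₀..a₁, ((a₁ - s) * (z a₀).toReal + (s - a₀) * (z a₁).toReal) =
        (a₁ - a₀) * ((a₁ - a₀) * ((z a₀).toReal + (z a₁).toReal) / 2) := by
        rw [intervalIntegral.integral_add (by apply Continuous.intervalIntegrable; fun_prop)
          (by apply Continuous.intervalIntegrable; fun_prop)]
        simp only [intervalIntegral.integral_mul_const]
        rw [intervalIntegral.integral_sub (by simp) (by simp), intervalIntegral.integral_sub (by simp) (by simp)]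
        simp
        ring
      rw [← e, ← intervalIntegral.integral_const_mul]
      refine intervalIntegral.integral_mono_on h ((i0.symm.trans i1).const_mul _)
        (by apply Continuous.intervalIntegrable; fun_prop) fun s hs => ?_
      exact (aux_chord z hz h0 h1 hs.1 hs.2).2
    rw [← intervalIntegral.integral_interval_sub_left i1 i0] at key
    rcases eq_or_lt_of_le h with rfl | h
    · simp
    have := le_of_mul_le_mul_left key (sub_pos.2 h)
    nlinarith [mul_le_mul_of_nonneg_left hs p0]
  · have key : (a₀ - a₁) * (z a₀).toReal - b₀ * (a₀ - a₁) ^ 2 / 2 ≤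
        ∫ s in a₁..a₀, (z s).toReal := by
      have e : ∫ s in a₁..a₀, ((z a₀).toReal + b₀ * (s - a₀)) =
          (a₀ - a₁) * (z a₀).toReal - b₀ * (a₀ - a₁) ^ 2 / 2 := by
        rw [intervalIntegral.integral_add (by simp)
          (by apply Continuous.intervalIntegrable; fun_prop)]
        simp only [intervalIntegral.integral_const_mul]
        rw [intervalIntegral.integral_sub (by simp) (by simp)]
        simp
        ring
      rw [← e]
      refine intervalIntegral.integral_mono_on h (by apply Continuous.intervalIntegrable; fun_prop)
        (i1.symm.trans i0) fun s hs => ?_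
      exact aux_sub z hz h0 (aux_chord z hz h1 h0 hs.1 hs.2).1 hb
    rw [← intervalIntegral.integral_interval_sub_left i0 i1] at key
    nlinarith [mul_le_mul_of_nonneg_left hs p1]

/-- The key convexity inequality `e(a₁) - e(a₀) ≥ (a₁ - a₀)(a₀ b₀ - z(a₀))` for
`b₀ ∈ ∂z(a₀)`; consequently `a₀ b₀ - z(a₀) ∈ ∂e(a₀)`. -/
theorem statement7 (z : ℝ → EReal) (hz : IsEnergy z) :
    (∀ a₀ a₁ : ℝ, z a₀ ≠ ⊤ → z a₁ ≠ ⊤ → ∀ b₀ ∈ subdiff z a₀,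
      eFun z a₀ + (((a₁ - a₀) * (a₀ * b₀ - (z a₀).toReal) : ℝ) : EReal) ≤ eFun z a₁) ∧
    (∀ a₀ : ℝ, z a₀ ≠ ⊤ → ∀ b₀ ∈ subdiff z a₀,
      (a₀ * b₀ - (z a₀).toReal) ∈ subdiff (eFun z) a₀) := by
  have key : ∀ a₀ a₁ : ℝ, z a₀ ≠ ⊤ → z a₁ ≠ ⊤ → ∀ b₀ ∈ subdiff z a₀,
      eFun z a₀ + (((a₁ - a₀) * (a₀ * b₀ - (z a₀).toReal) : ℝ) : EReal) ≤ eFun z a₁ := by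
    intro a₀ a₁ h0 h1 b₀ hb
    unfold eFun
    rw [if_neg h0, if_neg h1, ← EReal.coe_add, EReal.coe_le_coe_iff]
    exact aux_real z hz h0 h1 hb
  refine ⟨key, fun a₀ h0 b₀ hb x => ?_⟩
  by_cases hx : z x = ⊤
  · have : eFun z x = ⊤ := by unfold eFun; rw [if_pos hx]
    rw [this]; exact le_top
  · rw [mul_comm]
    exact key a₀ x h0 hx b₀ hb
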